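/- For γ = 3, the pair of functions u₁(x) = (1 + tanh(x/√2))/2 and u₂(x) = (1 − tanh(x/√2))/2 satisfies the system −u₁'' + (u₁² + 3u₂² − 1)u₁ = 0, −u₂'' + (3u₁² + u₂² − 1)u₂ = 0 on the real line, together with the boundary conditions u₁ → 0, u₂ → 1 as x → −∞ and u₁ → 1, u₂ → 0 as x → +∞. -/

import Mathlib

open Filter Real

lemma tanh_hasDerivAt_aux (y : ℝ) : HasDerivAt Real.tanh (1 - Real.tanh y ^ 2) y := by
  have hc : Real.cosh y ≠ 0 := (Real.cosh_pos y).ne'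
  have h := (Real.hasDerivAt_sinh y).div (Real.hasDerivAt_cosh y) hc
  have e : Real.tanh = Real.sinh / Real.cosh := by
    funext z
    simp [Real.tanh_eq_sinh_div_cosh]
  rw [← e] at h
  refine h.congr_deriv ?_
  rw [Real.tanh_eq_sinh_div_cosh]
  field_simp

lemma tanh_scaled_hasDerivAt (x : ℝ) :
    HasDerivAt (fun x => Real.tanh (x / Real.sqrt 2))
      ((1 - Real.tanh (x / Real.sqrt 2) ^ 2) * (1 / Real.sqrt 2)) x :=
  HasDerivAt.comp (h₂ := Real.tanh) (h := fun x : ℝ => x / Real.sqrt 2) x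
    (tanh_hasDerivAt_aux (x / Real.sqrt 2)) ((hasDerivAt_id x).div_const (Real.sqrt 2))

lemma tanh_scaled_hasDerivAt_two (x : ℝ) :
    HasDerivAt (fun x => (1 - Real.tanh (x / Real.sqrt 2) ^ 2) * (1 / Real.sqrt 2))
      (-(Real.tanh (x / Real.sqrt 2) * (1 - Real.tanh (x / Real.sqrt 2) ^ 2))) x := by
  have h := (((tanh_scaled_hasDerivAt x).pow 2).const_sub 1).mul_const (1 / Real.sqrt 2)
  refine h.congr_deriv ?_
  have hs : (1 / Real.sqrt 2) * (1 / Real.sqrt 2) = 1 / 2 := by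
    rw [div_mul_div_comm, Real.mul_self_sqrt (by norm_num)]
    norm_num
  simp only [Nat.cast_ofNat, Nat.add_one_sub_one, pow_one]
  linear_combination
    (-2 * Real.tanh (x / Real.sqrt 2) * (1 - Real.tanh (x / Real.sqrt 2) ^ 2)) * hs

lemma tanh_tendsto_atTop_aux : Tendsto Real.tanh atTop (nhds 1) := by
  have e : Real.tanh = fun x => 1 - 2 / (Real.exp (2 * x) + 1) := by
    funext x
    rw [Real.tanh_eq, Real.exp_neg, two_mul, Real.exp_add]
    have := Real.exp_pos x
    field_simp
    ring
  rw [e]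
  have h1 : Tendsto (fun x : ℝ => Real.exp (2 * x) + 1) atTop atTop :=
    tendsto_atTop_add_const_right _ _
      (Real.tendsto_exp_atTop.comp (tendsto_id.const_mul_atTop (by norm_num)))
  simpa using (h1.const_div_atTop 2).const_sub 1

lemma tanh_tendsto_atBot_aux : Tendsto Real.tanh atBot (nhds (-1)) := by
  have h := (tanh_tendsto_atTop_aux.comp tendsto_neg_atBot_atTop).neg
  refine h.congr fun x => ?_
  simp [Real.tanh_neg]

theorem exact_domain_wall_gamma_three
    (u₁ u₂ : ℝ → ℝ)
    (h₁ : u₁ = fun x => (1 + Real.tanh (x / Real.sqrt 2)) / 2)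
    (h₂ : u₂ = fun x => (1 - Real.tanh (x / Real.sqrt 2)) / 2) :
    (∀ x : ℝ, -(deriv (deriv u₁) x) + (u₁ x ^ 2 + 3 * u₂ x ^ 2 - 1) * u₁ x = 0) ∧
    (∀ x : ℝ, -(deriv (deriv u₂) x) + (3 * u₁ x ^ 2 + u₂ x ^ 2 - 1) * u₂ x = 0) ∧
    Tendsto u₁ atBot (nhds 0) ∧ Tendsto u₂ atBot (nhds 1) ∧
    Tendsto u₁ atTop (nhds 1) ∧ Tendsto u₂ atTop (nhds 0) := by
  have hs : 0 < Real.sqrt 2 := by positivity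
  have d₁ : deriv u₁ = fun x =>
      ((1 - Real.tanh (x / Real.sqrt 2) ^ 2) * (1 / Real.sqrt 2)) / 2 := by
    funext x
    rw [h₁]
    exact (((tanh_scaled_hasDerivAt x).const_add 1).div_const 2).deriv
  have d₂ : deriv u₂ = fun x =>
      (-((1 - Real.tanh (x / Real.sqrt 2) ^ 2) * (1 / Real.sqrt 2))) / 2 := by
    funext x
    rw [h₂]
    exact (((tanh_scaled_hasDerivAt x).const_sub 1).div_const 2).deriv
  have tT : Tendsto (fun x => Real.tanh (x / Real.sqrt 2)) atTop (nhds 1) :=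
    tanh_tendsto_atTop_aux.comp (tendsto_id.atTop_div_const hs)
  have tB : Tendsto (fun x => Real.tanh (x / Real.sqrt 2)) atBot (nhds (-1)) :=
    tanh_tendsto_atBot_aux.comp (tendsto_id.atBot_div_const hs)
  refine ⟨fun x => ?_, fun x => ?_, ?_, ?_, ?_, ?_⟩
  · have := ((tanh_scaled_hasDerivAt_two x).div_const 2).deriv
    rw [d₁, this, h₁, h₂]
    ring
  · have := ((tanh_scaled_hasDerivAt_two x).fun_neg.div_const 2).deriv
    rw [d₂, this, h₁, h₂]
    ring
  · rw [h₁]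
    simpa using (tB.const_add 1).div_const 2
  · rw [h₂]
    convert (tB.const_sub 1).div_const 2 using 2
    norm_num
  · rw [h₁]
    convert (tT.const_add 1).div_const 2 using 2
    norm_num
  · rw [h₂]
    simpa using (tT.const_sub 1).div_const 2
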